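/- arXiv:2104.14744 — 6 statements merged into one kernel-verified Lean document; each statement's English description precedes it below -/
import Mathlib

section
/- Let A, B : Fin m → Fin k → ℝ be two payoff matrices with |A i j − B i j| ≤ ε for all i, j, and let (x*, y*) be a Nash equilibrium of the zero-sum game A, i.e., u(A, x, y*) ≤ u(A, x*, y*) ≤ u(A, x*, y) for all row mixed strategies x and column mixed strategies y. Then the exploitability of x* in the game B is at most 2ε: v(B) − inf over column mixed strategies y of u(B, x*, y) ≤ 2ε. -/
open Set

/-- Expected payoff to the row player in a two-player zero-sum game with payoff
matrix `A`, when the row player plays mixed strategy `x` and the column player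
plays mixed strategy `y`. -/
noncomputable def payoff {m k : ℕ} (A : Fin m → Fin k → ℝ)
    (x : Fin m → ℝ) (y : Fin k → ℝ) : ℝ :=
  ∑ i, ∑ j, x i * y j * A i j

/-- The value of the zero-sum game `A`: the sup over row mixed strategies of the
inf over column mixed strategies of the expected payoff. -/
noncomputable def gameValue {m k : ℕ} (A : Fin m → Fin k → ℝ) : ℝ :=
  ⨆ x : stdSimplex ℝ (Fin m), ⨅ y : stdSimplex ℝ (Fin k), payoff A x.1 y.1

theorem abs_payoff_sub_payoff_le {m k : ℕ} {A B : Fin m → Fin k → ℝ} {ε : ℝ}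
    (hAB : ∀ (i : Fin m) (j : Fin k), |A i j - B i j| ≤ ε)
    {x : Fin m → ℝ} {y : Fin k → ℝ}
    (hx : x ∈ stdSimplex ℝ (Fin m)) (hy : y ∈ stdSimplex ℝ (Fin k)) :
    |payoff A x y - payoff B x y| ≤ ε := by
  have hsum : ∑ i, ∑ j, x i * y j * ε = ε := by
    simp_rw [← Finset.sum_mul, ← Finset.mul_sum, hy.2, mul_one, hx.2, one_mul]
  have hsub : payoff A x y - payoff B x y = ∑ i, ∑ j, x i * y j * (A i j - B i j) := by
    simp only [payoff, mul_sub, Finset.sum_sub_distrib]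
  rw [hsub]
  refine le_trans (Finset.abs_sum_le_sum_abs _ _) (le_trans ?_ hsum.le)
  refine Finset.sum_le_sum fun i _ => le_trans (Finset.abs_sum_le_sum_abs _ _) ?_
  refine Finset.sum_le_sum fun j _ => ?_
  have hxy : 0 ≤ x i * y j := mul_nonneg (hx.1 i) (hy.1 j)
  rw [abs_mul, abs_of_nonneg hxy]
  exact mul_le_mul_of_nonneg_left (hAB i j) hxy

theorem bddBelow_range_payoff {m k : ℕ} (A : Fin m → Fin k → ℝ) (x : Fin m → ℝ) :
    BddBelow (range fun y : stdSimplex ℝ (Fin k) => payoff A x y.1) := by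
  have : CompactSpace (stdSimplex ℝ (Fin k)) :=
    isCompact_iff_compactSpace.mp (isCompact_stdSimplex ℝ (Fin k))
  have hcont : Continuous fun y : Fin k → ℝ => payoff A x y := by
    unfold payoff
    fun_prop
  exact (isCompact_range (hcont.comp continuous_subtype_val)).bddBelow

/-- If `(x*, y*)` is a Nash equilibrium of the zero-sum game `A`, and
all payoffs of `B` are within ε of those of `A`, then the exploitability of `x*`
in `B` is at most `2ε`. -/
theorem exploitability_le_of_payoffs_close
    {m k : ℕ} (A B : Fin m → Fin k → ℝ) (ε : ℝ)
    (hAB : ∀ (i : Fin m) (j : Fin k), |A i j - B i j| ≤ ε)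
    (xstar : Fin m → ℝ) (ystar : Fin k → ℝ)
    (hx : xstar ∈ stdSimplex ℝ (Fin m)) (hy : ystar ∈ stdSimplex ℝ (Fin k))
    (hNash1 : ∀ x ∈ stdSimplex ℝ (Fin m), payoff A x ystar ≤ payoff A xstar ystar)
    (hNash2 : ∀ y ∈ stdSimplex ℝ (Fin k), payoff A xstar ystar ≤ payoff A xstar y) :
    gameValue B - (⨅ y : stdSimplex ℝ (Fin k), payoff B xstar y.1) ≤ 2 * ε := by
  have : Nonempty (stdSimplex ℝ (Fin m)) := ⟨⟨xstar, hx⟩⟩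
  have : Nonempty (stdSimplex ℝ (Fin k)) := ⟨⟨ystar, hy⟩⟩
  have hvalue : gameValue B ≤ payoff A xstar ystar + ε := by
    refine ciSup_le fun x => ?_
    have h := ciInf_le (bddBelow_range_payoff B x.1) ⟨ystar, hy⟩
    have hclose := abs_le.mp (abs_payoff_sub_payoff_le hAB x.2 hy)
    linarith [hNash1 x.1 x.2, hclose.1]
  have hinf : payoff A xstar ystar - ε ≤ ⨅ y : stdSimplex ℝ (Fin k), payoff B xstar y.1 := by
    refine le_ciInf fun y => ?_
    have hclose := abs_le.mp (abs_payoff_sub_payoff_le hAB hx y.2)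
    linarith [hNash2 y.1 y.2, hclose.2]
  linarith
end

section
/- Consider a two-player 2×2 general-sum game with real payoff parameters a,b,c,d,e,f,g,h. If there exists a Nash equilibrium (σ, τ) in mixed strategies in which one player's strategy is pure (places probability 1 on a single pure strategy) and the other player's strategy places strictly positive probability on both pure strategies, then the game possesses a pure-strategy Nash equilibrium, i.e., at least one of the following holds: (a ≥ e and b ≥ d), (c ≥ g and d ≥ b), (e ≥ a and f ≥ h), or (g ≥ c and h ≥ f). -/
open Set

/-- Row player's expected utility in the 2×2 game `M = [[(a,b),(c,d)],[(e,f),(g,h)]]`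
when the row player plays Top with probability `p` and the column player plays
Left with probability `q`. -/
def rowU (a c e g p q : ℝ) : ℝ :=
  p * q * a + p * (1 - q) * c + (1 - p) * q * e + (1 - p) * (1 - q) * g

/-- Column player's expected utility in the 2×2 game `M = [[(a,b),(c,d)],[(e,f),(g,h)]]`
when the row player plays Top with probability `p` and the column player plays
Left with probability `q`. -/
def colU (b d f h p q : ℝ) : ℝ :=
  p * q * b + p * (1 - q) * d + (1 - p) * q * f + (1 - p) * (1 - q) * h

/-- If a strict convex combination of two reals is nonnegative, one of them is. -/
theorem nonneg_or_nonneg_of_convex_comb {t x y : ℝ} (ht₀ : 0 < t) (ht₁ : t < 1)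
    (hxy : 0 ≤ t * x + (1 - t) * y) : 0 ≤ x ∨ 0 ≤ y := by
  by_contra! hneg
  nlinarith [mul_pos ht₀ (neg_pos.2 hneg.1), mul_pos (sub_pos.2 ht₁) (neg_pos.2 hneg.2)]

/-- A strict convex combination that dominates both of its terms has equal terms. -/
theorem eq_of_le_convex_comb {t x y : ℝ} (ht₀ : 0 < t) (ht₁ : t < 1)
    (hx : x ≤ t * x + (1 - t) * y) (hy : y ≤ t * x + (1 - t) * y) : x = y := by
  apply le_antisymm
  · exact le_of_mul_le_mul_left (by linarith) (sub_pos.2 ht₁)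
  · exact le_of_mul_le_mul_left (by linarith) ht₀

/-- In a 2×2 general-sum game, if there is a Nash equilibrium in
which one player's strategy is pure and the other player's strategy has full
support (both pure strategies with strictly positive probability), then the game
has a pure-strategy Nash equilibrium. -/
theorem pure_equilibrium_of_mixed_pure_support
    (a b c d e f g h p q : ℝ)
    (hp : p ∈ Icc (0:ℝ) 1) (hq : q ∈ Icc (0:ℝ) 1)
    (hNashRow : ∀ p' ∈ Icc (0:ℝ) 1, rowU a c e g p' q ≤ rowU a c e g p q)
    (hNashCol : ∀ q' ∈ Icc (0:ℝ) 1, colU b d f h p q' ≤ colU b d f h p q)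
    (hsupp : ((p = 0 ∨ p = 1) ∧ 0 < q ∧ q < 1) ∨ ((q = 0 ∨ q = 1) ∧ 0 < p ∧ p < 1)) :
    (a ≥ e ∧ b ≥ d) ∨ (c ≥ g ∧ d ≥ b) ∨ (e ≥ a ∧ f ≥ h) ∨ (g ≥ c ∧ h ≥ f) := by
  have row₀ := hNashRow 0 (by simp)
  have row₁ := hNashRow 1 (by simp)
  have col₀ := hNashCol 0 (by simp)
  have col₁ := hNashCol 1 (by simp)
  simp only [rowU, colU] at row₀ row₁ col₀ col₁
  rcases hsupp with ⟨rfl | rfl, h₀, h₁⟩ | ⟨rfl | rfl, h₀, h₁⟩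
  · have hfh : f = h := eq_of_le_convex_comb h₀ h₁ (by linarith) (by linarith)
    rcases nonneg_or_nonneg_of_convex_comb (x := e - a) (y := g - c) h₀ h₁ (by linarith)
      with hx | hx
    · exact .inr (.inr (.inl ⟨sub_nonneg.1 hx, hfh.ge⟩))
    · exact .inr (.inr (.inr ⟨sub_nonneg.1 hx, hfh.le⟩))
  · have hbd : b = d := eq_of_le_convex_comb h₀ h₁ (by linarith) (by linarith)
    rcases nonneg_or_nonneg_of_convex_comb (x := a - e) (y := c - g) h₀ h₁ (by linarith)
      with hx | hx
    · exact .inl ⟨sub_nonneg.1 hx, hbd.ge⟩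
    · exact .inr (.inl ⟨sub_nonneg.1 hx, hbd.le⟩)
  · have hcg : c = g := eq_of_le_convex_comb h₀ h₁ (by linarith) (by linarith)
    rcases nonneg_or_nonneg_of_convex_comb (x := d - b) (y := h - f) h₀ h₁ (by linarith)
      with hx | hx
    · exact .inr (.inl ⟨hcg.ge, sub_nonneg.1 hx⟩)
    · exact .inr (.inr (.inr ⟨hcg.le, sub_nonneg.1 hx⟩))
  · have hae : a = e := eq_of_le_convex_comb h₀ h₁ (by linarith) (by linarith)
    rcases nonneg_or_nonneg_of_convex_comb (x := b - d) (y := f - h) h₀ h₁ (by linarith)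
      with hx | hx
    · exact .inl ⟨hae.ge, sub_nonneg.1 hx⟩
    · exact .inr (.inr (.inl ⟨hae.le, sub_nonneg.1 hx⟩))
end

section
/- Consider a two-player 2×2 general-sum game with real payoff parameters a,b,c,d,e,f,g,h, and suppose none of the four pure-strategy equilibrium conditions holds, i.e., ¬(a ≥ e ∧ b ≥ d), ¬(c ≥ g ∧ d ≥ b), ¬(e ≥ a ∧ f ≥ h), and ¬(g ≥ c ∧ h ≥ f). Then b − f + h − d ≠ 0 and a − c + g − e ≠ 0, the quantities p = (h−f)/(b−f+h−d) and q = (g−c)/(a−c+g−e) lie in [0,1], and the mixed strategy profile in which the row player plays Top with probability p (Bottom with probability 1−p) and the column player plays Left with probability q (Right with probability 1−q) is a Nash equilibrium. -/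
open Set

lemma rowU_eq_of_indifferent {a c e g q : ℝ} (hq : q * (a - c + g - e) = g - c) (p p' : ℝ) :
    rowU a c e g p q = rowU a c e g p' q := by
  unfold rowU
  linear_combination (p - p') * hq

lemma colU_eq_of_indifferent {b d f h p : ℝ} (hp : p * (b - f + h - d) = h - f) (q q' : ℝ) :
    colU b d f h p q = colU b d f h p q' := by
  unfold colU
  linear_combination (q - q') * hp

lemma payoff_differences_cyclic {a b c d e f g h : ℝ}
    (h1 : ¬(a ≥ e ∧ b ≥ d)) (h2 : ¬(c ≥ g ∧ d ≥ b))
    (h3 : ¬(e ≥ a ∧ f ≥ h)) (h4 : ¬(g ≥ c ∧ h ≥ f)) :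
    (e < a ∧ b < d ∧ c < g ∧ h < f) ∨ (a < e ∧ d < b ∧ g < c ∧ f < h) := by
  grind

lemma div_mem_Icc_of_same_sign {x y s : ℝ} (hs : s = x + y)
    (hxy : (0 < x ∧ 0 < y) ∨ (x < 0 ∧ y < 0)) : s ≠ 0 ∧ y / s ∈ Icc (0 : ℝ) 1 := by
  subst hs
  rcases hxy with ⟨hx, hy⟩ | ⟨hx, hy⟩
  · exact ⟨(add_pos hx hy).ne', by positivity, (div_le_one (by linarith)).2 (by linarith)⟩
  · exact ⟨(add_neg hx hy).ne, div_nonneg_of_nonpos hy.le (by linarith),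
      (div_le_one_of_neg (by linarith)).2 (by linarith)⟩

/-- In a 2×2 general-sum game with no pure-strategy equilibrium
(none of the four pure equilibrium conditions holds), the denominators
`b - f + h - d` and `a - c + g - e` are nonzero, the probabilities
`p = (h-f)/(b-f+h-d)` and `q = (g-c)/(a-c+g-e)` lie in `[0,1]`, and the profile
(row plays Top w.p. `p`, column plays Left w.p. `q`) is a Nash equilibrium. -/
theorem mixed_equilibrium_of_no_pure
    (a b c d e f g h : ℝ)
    (h1 : ¬(a ≥ e ∧ b ≥ d)) (h2 : ¬(c ≥ g ∧ d ≥ b))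
    (h3 : ¬(e ≥ a ∧ f ≥ h)) (h4 : ¬(g ≥ c ∧ h ≥ f)) :
    b - f + h - d ≠ 0 ∧ a - c + g - e ≠ 0 ∧
    (h - f) / (b - f + h - d) ∈ Icc (0:ℝ) 1 ∧
    (g - c) / (a - c + g - e) ∈ Icc (0:ℝ) 1 ∧
    (∀ p' ∈ Icc (0:ℝ) 1,
      rowU a c e g p' ((g - c) / (a - c + g - e)) ≤
        rowU a c e g ((h - f) / (b - f + h - d)) ((g - c) / (a - c + g - e))) ∧
    (∀ q' ∈ Icc (0:ℝ) 1,
      colU b d f h ((h - f) / (b - f + h - d)) q' ≤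
        colU b d f h ((h - f) / (b - f + h - d)) ((g - c) / (a - c + g - e))) := by
  have hcyc := payoff_differences_cyclic h1 h2 h3 h4
  obtain ⟨hp0, hp⟩ := div_mem_Icc_of_same_sign (x := b - d) (y := h - f)
    (s := b - f + h - d) (by ring) (by grind)
  obtain ⟨hq0, hq⟩ := div_mem_Icc_of_same_sign (x := a - e) (y := g - c)
    (s := a - c + g - e) (by ring) (by grind)
  exact ⟨hp0, hq0, hp, hq,
    fun p' _ => (rowU_eq_of_indifferent (div_mul_cancel₀ _ hq0) _ _).le,
    fun q' _ => (colU_eq_of_indifferent (div_mul_cancel₀ _ hp0) _ _).le⟩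
end

section
/- In the simplified Final Jeopardy game with parameters p1, p2 ∈ [0,1], if p1 ≥ 1/2 and p2 ≥ 1/2, then the pure strategy pair (wager 2, wager 2), i.e., (i,j) = (2,2), is a pure-strategy Nash equilibrium. -/
open Set

/-- Player 1's payoff matrix in the simplified Final Jeopardy game with
parameters `p1, p2` (player 1 wagers `i ∈ {0,…,5}`, player 2 wagers
`j ∈ {0,…,3}`; player 2's payoff is the negative). -/
noncomputable def FJ (p1 p2 : ℝ) : Fin 6 → Fin 4 → ℝ :=
  ![![0.5, 0.5, 0.5 - 0.5 * p2, 0.5 - p2],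
    ![0.5, 0.5 * p1 * p2 - 0.5 * p2 + 0.5, 0.5 - p2, 0.5 + 0.5 * p1 * p2 - p2],
    ![0.5 * p1, 0.5 - p2 + p1 * p2, 0.5 - p2 + p1 * p2, 0.5 - p2 + p1 * p2],
    ![p1 - 0.5, 0.5 * p1 * p2 + 0.5 * p1 - 0.5 * p2, 0.5 - p2 + p1 * p2,
      0.5 - p2 + p1 * p2],
    ![p1 - 0.5, p1 - 0.5, 0.5 * p1 * p2 + 0.5 * p1 - 0.5 * p2, 0.5 - p2 + p1 * p2],
    ![p1 - 0.5, p1 - 0.5, p1 - 0.5, 0.5 * p1 * p2 + 0.5 * p1 - 0.5 * p2]]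

/-- `(i, j)` is a pure-strategy Nash equilibrium of the zero-sum game with
player-1 payoff matrix `M`: `i` maximizes player 1's payoff against `j`, and `j`
minimizes player 1's payoff (i.e. maximizes player 2's payoff) against `i`. -/
def IsPureNash (M : Fin 6 → Fin 4 → ℝ) (i : Fin 6) (j : Fin 4) : Prop :=
  (∀ i' : Fin 6, M i' j ≤ M i j) ∧ (∀ j' : Fin 4, M i j ≤ M i j')

/-- In simplified Final Jeopardy, if `p1 ≥ 1/2` and `p2 ≥ 1/2` then
`(wager 2, wager 2)` is a pure-strategy Nash equilibrium. -/
theorem fj_pure_nash_two_two (p1 p2 : ℝ)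
    (hp1 : p1 ∈ Icc (0:ℝ) 1) (hp2 : p2 ∈ Icc (0:ℝ) 1)
    (h1 : 1 / 2 ≤ p1) (h2 : 1 / 2 ≤ p2) :
    IsPureNash (FJ p1 p2) 2 2 := by
  obtain ⟨-, hp1⟩ := hp1
  obtain ⟨hp2, hp2'⟩ := hp2
  have h_half : 0 ≤ (p1 - 1 / 2) * p2 := mul_nonneg (by linarith) hp2
  have h_prod : 0 ≤ p1 * p2 := mul_nonneg (by linarith) hp2
  have h_compl : 0 ≤ (1 - p1) * (1 - p2) := mul_nonneg (by linarith) (by linarith)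
  have h_col : 0 ≤ (1 - p1) * (p2 - 1 / 2) := mul_nonneg (by linarith) (by linarith)
  constructor
  · intro i
    fin_cases i <;> simp [FJ] <;> linarith
  · intro j
    fin_cases j <;> simp [FJ]
    linarith
end

section
/- In the simplified Final Jeopardy game with parameters p1, p2 ∈ [0,1], if 0 < p1 < 1/2 and p2 ≥ 1/2, then the pure strategy pair (wager 2, wager 3), i.e., (i,j) = (2,3), is a pure-strategy Nash equilibrium. -/
open Set

/-- In simplified Final Jeopardy, if `0 < p1 < 1/2` and `p2 ≥ 1/2`
then `(wager 2, wager 3)` is a pure-strategy Nash equilibrium. -/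
theorem fj_pure_nash_two_three (p1 p2 : ℝ)
    (hp1 : p1 ∈ Icc (0:ℝ) 1) (hp2 : p2 ∈ Icc (0:ℝ) 1)
    (h1 : 0 < p1) (h1' : p1 < 1 / 2) (h2 : 1 / 2 ≤ p2) :
    IsPureNash (FJ p1 p2) 2 3 := by
  obtain ⟨-, hp2⟩ := hp2
  have h_row : 0 ≤ p1 * p2 := mul_nonneg h1.le (by linarith)
  have h_all_in : 0 ≤ (1 - p1) * (1 - p2) := mul_nonneg (by linarith) (by linarith)
  have h_zero : 0 ≤ (1 - p1) * (p2 - 1 / 2) := mul_nonneg (by linarith) (by linarith)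
  constructor
  · intro i
    fin_cases i <;> simp [FJ] <;> linarith
  · intro j
    fin_cases j <;> simp [FJ] <;> linarith
end

section
/- Let p1, p2, y1, y2 be real numbers with p1, y1, y2 ∈ [0,1] and 0 ≤ p2 ≤ p1/2. Then 2y2p1 + y1p1 + 3y1y2p2 ≥ 2y1p2 + y2p2 + 3y1y2p1. (In the Weakest Link final-voting model, this says that if p2 ≤ p1/2 then voting for player 2, the stronger player, is always optimal regardless of the opponents' voting probabilities y1, y2.) -/
open Set

/-- In the Weakest Link final-voting model, if `p2 ≤ p1/2` then
voting for player 2 (the stronger player) is always weakly optimal, regardless of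
the opponents' voting probabilities `y1, y2`:
`2y2p1 + y1p1 + 3y1y2p2 ≥ 2y1p2 + y2p2 + 3y1y2p1`. -/
theorem weakest_link_vote_strong_player
    (p1 p2 y1 y2 : ℝ)
    (hp1 : p1 ∈ Icc (0:ℝ) 1) (hy1 : y1 ∈ Icc (0:ℝ) 1) (hy2 : y2 ∈ Icc (0:ℝ) 1)
    (hp2 : 0 ≤ p2) (hp2' : p2 ≤ p1 / 2) :
    2 * y2 * p1 + y1 * p1 + 3 * y1 * y2 * p2 ≥
      2 * y1 * p2 + y2 * p2 + 3 * y1 * y2 * p1 := by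
  obtain ⟨hy1₀, hy1₁⟩ := hy1
  obtain ⟨hy2₀, hy2₁⟩ := hy2
  have h₁ : 0 ≤ y1 * (1 - y2) * (p1 - 2 * p2) :=
    mul_nonneg (mul_nonneg hy1₀ (by linarith)) (by linarith)
  have h₂ : 0 ≤ y2 * (1 - y1) * (2 * p1 - p2) :=
    mul_nonneg (mul_nonneg hy2₀ (by linarith)) (by linarith)
  linarith
end
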